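/- Recovering the call-by-value linear-use CPS translation: for every simple type σ, σᵛᶜ = (σᵛ)ᶜ as value types of EEC; and for every simply-typed term Θ ⊢ M : σ, we have Θᵛᶜ ⊢ Mᵛᶜ = (Mᵛ)ᶜ : (σᵛᶜ ⇒ R̲) ⊸ R̲ in the equational theory of EEC. That is, the cbv linear-use CPS translation equals the composite of the standard cbv translation into EEC with the generic linear-use CPS self-translation of EEC. -/

import Mathlib

set_option autoImplicit false

namespace EEC

/-! # The enriched effect calculus (EEC)

A deep embedding of the enriched effect calculus of Egger, Møgelberg and
Simpson: value types and computation types, raw terms (de Bruijn indices for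
value variables, together with a designated stoup variable `svar`), typing
derivations with an (at most singleton) stoup, the βη-equational theory, the
simply-typed λ-calculus together with βη-equality and Moggi's computational
λ-calculus equality, the standard cbv/cbn translations of typed λ-calculus
into EEC, Hasegawa's linear-use CPS translations, and the generic linear-use
CPS self-translation of EEC. -/

mutual
  /-- Value types of EEC. -/
  inductive VType : Type
    | base : ℕ → VType                 -- value type constants α
    | unit : VType                     -- 1
    | prod : VType → VType → VType     -- A × B
    | arr : VType → VType → VType      -- A → B
    | comp : CType → VType             -- every computation type is a value type
    | lin : CType → CType → VType      -- A̲ ⊸ B̲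
  /-- Computation types of EEC. -/
  inductive CType : Type
    | base : ℕ → CType                 -- computation type constants α̲
    | cunit : CType                    -- 1̲
    | cand : CType → CType → CType     -- A̲ & B̲
    | carr : VType → CType → CType     -- A ⇒ B̲
    | iunit : CType                    -- I̲
    | bang : VType → CType             -- !A
    | copow : VType → CType → CType    -- !A ⊗ B̲
    | czero : CType                    -- 0̲
    | csum : CType → CType → CType     -- A̲ ⊕ B̲
end

/-- Raw terms of EEC.  Value variables are de Bruijn indices (`var n`, with
`var 0` the innermost bound variable); the unique stoup variable is `svar`
(the constructs `llam`, `copowlet` (in its body) and `ccase` (in its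
branches) bind the stoup variable). -/
inductive Tm : Type
  | var : ℕ → Tm                -- value variable
  | svar : Tm                   -- the stoup variable
  | unit : Tm                   -- * : 1
  | vpair : Tm → Tm → Tm        -- ⟨t,u⟩
  | vfst : Tm → Tm
  | vsnd : Tm → Tm
  | vlam : VType → Tm → Tm      -- λx:A. t
  | vapp : Tm → Tm → Tm
  | cunit : Tm                  -- ⋆ : 1̲
  | cpair : Tm → Tm → Tm        -- ⟨t,u⟩ : A̲ & B̲
  | cfst : Tm → Tm
  | csnd : Tm → Tm
  | clam : VType → Tm → Tm      -- λx:A ⇒ t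
  | capp : Tm → Tm → Tm         -- s ⋅ t
  | top : Tm                    -- ⊤ : I̲
  | ilet : Tm → Tm → Tm         -- t to ⊤. u
  | bang : Tm → Tm              -- !t
  | banglet : Tm → Tm → Tm      -- let !x = t in u   (binds a value variable in u)
  | copow : Tm → Tm → Tm        -- !t ⊗ u
  | copowlet : Tm → Tm → Tm     -- let !x⊗y = s in t (binds a value variable and the stoup variable in t)
  | cimage : CType → Tm → Tm    -- image_{A̲}(t)
  | cinl : Tm → Tm
  | cinr : Tm → Tm
  | ccase : Tm → Tm → Tm → Tm   -- case s of (x. t | y. u)  (branches bind the stoup variable)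
  | llam : CType → Tm → Tm      -- λ°z:A̲. t (binds the stoup variable)
  | lapp : Tm → Tm → Tm         -- s[t]

namespace Tm

/-- Lift a renaming of value variables under a binder. -/
def liftN (f : ℕ → ℕ) : ℕ → ℕ
  | 0 => 0
  | n + 1 => f n + 1

/-- Renaming of value variables. -/
def rename (f : ℕ → ℕ) : Tm → Tm
  | .var n => .var (f n)
  | .svar => .svar
  | .unit => .unit
  | .vpair t u => .vpair (rename f t) (rename f u)
  | .vfst t => .vfst (rename f t)
  | .vsnd t => .vsnd (rename f t)
  | .vlam A t => .vlam A (rename (liftN f) t)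
  | .vapp s t => .vapp (rename f s) (rename f t)
  | .cunit => .cunit
  | .cpair t u => .cpair (rename f t) (rename f u)
  | .cfst t => .cfst (rename f t)
  | .csnd t => .csnd (rename f t)
  | .clam A t => .clam A (rename (liftN f) t)
  | .capp s t => .capp (rename f s) (rename f t)
  | .top => .top
  | .ilet t u => .ilet (rename f t) (rename f u)
  | .bang t => .bang (rename f t)
  | .banglet t u => .banglet (rename f t) (rename (liftN f) u)
  | .copow t u => .copow (rename f t) (rename f u)
  | .copowlet s t => .copowlet (rename f s) (rename (liftN f) t)
  | .cimage A t => .cimage A (rename f t)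
  | .cinl t => .cinl (rename f t)
  | .cinr t => .cinr (rename f t)
  | .ccase s t u => .ccase (rename f s) (rename f t) (rename f u)
  | .llam A t => .llam A (rename f t)
  | .lapp s t => .lapp (rename f s) (rename f t)

/-- Weakening of value variables. -/
def shift (t : Tm) : Tm := rename Nat.succ t

/-- Lift a parallel substitution of value variables under a binder. -/
def liftS (σ : ℕ → Tm) : ℕ → Tm
  | 0 => .var 0
  | n + 1 => shift (σ n)

/-- Parallel (capture-avoiding) substitution for value variables. -/
def psubst (σ : ℕ → Tm) : Tm → Tm
  | .var n => σ n
  | .svar => .svar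
  | .unit => .unit
  | .vpair t u => .vpair (psubst σ t) (psubst σ u)
  | .vfst t => .vfst (psubst σ t)
  | .vsnd t => .vsnd (psubst σ t)
  | .vlam A t => .vlam A (psubst (liftS σ) t)
  | .vapp s t => .vapp (psubst σ s) (psubst σ t)
  | .cunit => .cunit
  | .cpair t u => .cpair (psubst σ t) (psubst σ u)
  | .cfst t => .cfst (psubst σ t)
  | .csnd t => .csnd (psubst σ t)
  | .clam A t => .clam A (psubst (liftS σ) t)
  | .capp s t => .capp (psubst σ s) (psubst σ t)
  | .top => .top
  | .ilet t u => .ilet (psubst σ t) (psubst σ u)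
  | .bang t => .bang (psubst σ t)
  | .banglet t u => .banglet (psubst σ t) (psubst (liftS σ) u)
  | .copow t u => .copow (psubst σ t) (psubst σ u)
  | .copowlet s t => .copowlet (psubst σ s) (psubst (liftS σ) t)
  | .cimage A t => .cimage A (psubst σ t)
  | .cinl t => .cinl (psubst σ t)
  | .cinr t => .cinr (psubst σ t)
  | .ccase s t u => .ccase (psubst σ s) (psubst σ t) (psubst σ u)
  | .llam A t => .llam A (psubst σ t)
  | .lapp s t => .lapp (psubst σ s) (psubst σ t)

/-- Capture-avoiding substitution `t[u/x]` of a term `u` for the innermost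
value variable of `t`. -/
def subst0 (u : Tm) (t : Tm) : Tm :=
  psubst (fun n => match n with | 0 => u | m + 1 => .var m) t

/-- Capture-avoiding substitution `t[u/z]` of a term `u` for the stoup
variable of `t`.  The substitution stops at the stoup-variable binders
(`llam`-bodies, `copowlet`-bodies and `ccase`-branches). -/
def ssubst (u : Tm) : Tm → Tm
  | .var n => .var n
  | .svar => u
  | .unit => .unit
  | .vpair t t' => .vpair (ssubst u t) (ssubst u t')
  | .vfst t => .vfst (ssubst u t)
  | .vsnd t => .vsnd (ssubst u t)
  | .vlam A t => .vlam A (ssubst (shift u) t)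
  | .vapp s t => .vapp (ssubst u s) (ssubst u t)
  | .cunit => .cunit
  | .cpair t t' => .cpair (ssubst u t) (ssubst u t')
  | .cfst t => .cfst (ssubst u t)
  | .csnd t => .csnd (ssubst u t)
  | .clam A t => .clam A (ssubst (shift u) t)
  | .capp s t => .capp (ssubst u s) (ssubst u t)
  | .top => .top
  | .ilet t t' => .ilet (ssubst u t) (ssubst u t')
  | .bang t => .bang (ssubst u t)
  | .banglet t t' => .banglet (ssubst u t) (ssubst (shift u) t')
  | .copow t t' => .copow (ssubst u t) (ssubst u t')
  | .copowlet s t => .copowlet (ssubst u s) t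
  | .cimage A t => .cimage A (ssubst u t)
  | .cinl t => .cinl (ssubst u t)
  | .cinr t => .cinr (ssubst u t)
  | .ccase s t t' => .ccase (ssubst u s) t t'
  | .llam A t => .llam A t
  | .lapp s t => .lapp (ssubst u s) (ssubst u t)

end Tm

/-- Typing derivations of EEC (Figure 1 of the paper).  `Deriv Γ none t A`
is the judgement `Γ ⊢ t : A` (empty stoup); `Deriv Γ (some A̲) t (.comp B̲)`
is the judgement `Γ | z:A̲ ⊢ t : B̲`.  In the rules below `Δ` ranges over an
arbitrary (possibly empty) stoup. -/
inductive Deriv : List VType → Option CType → Tm → VType → Type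
  | var (Γ : List VType) (n : ℕ) (A : VType) :
      Γ[n]? = some A → Deriv Γ none (.var n) A
  | svar (Γ : List VType) (A : CType) : Deriv Γ (some A) .svar (.comp A)
  | unit (Γ : List VType) : Deriv Γ none .unit .unit
  | vpair (Γ : List VType) (t u : Tm) (A B : VType) :
      Deriv Γ none t A → Deriv Γ none u B → Deriv Γ none (.vpair t u) (.prod A B)
  | vfst (Γ : List VType) (t : Tm) (A B : VType) :
      Deriv Γ none t (.prod A B) → Deriv Γ none (.vfst t) A
  | vsnd (Γ : List VType) (t : Tm) (A B : VType) :
      Deriv Γ none t (.prod A B) → Deriv Γ none (.vsnd t) B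
  | vlam (Γ : List VType) (t : Tm) (A B : VType) :
      Deriv (A :: Γ) none t B → Deriv Γ none (.vlam A t) (.arr A B)
  | vapp (Γ : List VType) (s t : Tm) (A B : VType) :
      Deriv Γ none s (.arr A B) → Deriv Γ none t A → Deriv Γ none (.vapp s t) B
  | cunit (Γ : List VType) (Δ : Option CType) : Deriv Γ Δ .cunit (.comp .cunit)
  | cpair (Γ : List VType) (Δ : Option CType) (t u : Tm) (A B : CType) :
      Deriv Γ Δ t (.comp A) → Deriv Γ Δ u (.comp B) →
      Deriv Γ Δ (.cpair t u) (.comp (.cand A B))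
  | cfst (Γ : List VType) (Δ : Option CType) (t : Tm) (A B : CType) :
      Deriv Γ Δ t (.comp (.cand A B)) → Deriv Γ Δ (.cfst t) (.comp A)
  | csnd (Γ : List VType) (Δ : Option CType) (t : Tm) (A B : CType) :
      Deriv Γ Δ t (.comp (.cand A B)) → Deriv Γ Δ (.csnd t) (.comp B)
  | clam (Γ : List VType) (Δ : Option CType) (t : Tm) (A : VType) (B : CType) :
      Deriv (A :: Γ) Δ t (.comp B) → Deriv Γ Δ (.clam A t) (.comp (.carr A B))
  | capp (Γ : List VType) (Δ : Option CType) (s t : Tm) (A : VType) (B : CType) :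
      Deriv Γ Δ s (.comp (.carr A B)) → Deriv Γ none t A →
      Deriv Γ Δ (.capp s t) (.comp B)
  | top (Γ : List VType) : Deriv Γ none .top (.comp .iunit)
  | ilet (Γ : List VType) (Δ : Option CType) (t u : Tm) (A : CType) :
      Deriv Γ Δ t (.comp .iunit) → Deriv Γ none u (.comp A) →
      Deriv Γ Δ (.ilet t u) (.comp A)
  | bang (Γ : List VType) (t : Tm) (A : VType) :
      Deriv Γ none t A → Deriv Γ none (.bang t) (.comp (.bang A))
  | banglet (Γ : List VType) (Δ : Option CType) (t u : Tm) (A : VType) (B : CType) :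
      Deriv Γ Δ t (.comp (.bang A)) → Deriv (A :: Γ) none u (.comp B) →
      Deriv Γ Δ (.banglet t u) (.comp B)
  | copow (Γ : List VType) (Δ : Option CType) (t u : Tm) (A : VType) (B : CType) :
      Deriv Γ none t A → Deriv Γ Δ u (.comp B) →
      Deriv Γ Δ (.copow t u) (.comp (.copow A B))
  | copowlet (Γ : List VType) (Δ : Option CType) (s t : Tm) (A : VType) (B C : CType) :
      Deriv Γ Δ s (.comp (.copow A B)) → Deriv (A :: Γ) (some B) t (.comp C) →
      Deriv Γ Δ (.copowlet s t) (.comp C)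
  | cimage (Γ : List VType) (Δ : Option CType) (t : Tm) (A : CType) :
      Deriv Γ Δ t (.comp .czero) → Deriv Γ Δ (.cimage A t) (.comp A)
  | cinl (Γ : List VType) (Δ : Option CType) (t : Tm) (A B : CType) :
      Deriv Γ Δ t (.comp A) → Deriv Γ Δ (.cinl t) (.comp (.csum A B))
  | cinr (Γ : List VType) (Δ : Option CType) (t : Tm) (A B : CType) :
      Deriv Γ Δ t (.comp B) → Deriv Γ Δ (.cinr t) (.comp (.csum A B))
  | ccase (Γ : List VType) (Δ : Option CType) (s t u : Tm) (A B C : CType) :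
      Deriv Γ Δ s (.comp (.csum A B)) → Deriv Γ (some A) t (.comp C) →
      Deriv Γ (some B) u (.comp C) → Deriv Γ Δ (.ccase s t u) (.comp C)
  | llam (Γ : List VType) (t : Tm) (A B : CType) :
      Deriv Γ (some A) t (.comp B) → Deriv Γ none (.llam A t) (.lin A B)
  | lapp (Γ : List VType) (Δ : Option CType) (s t : Tm) (A B : CType) :
      Deriv Γ none s (.lin A B) → Deriv Γ Δ t (.comp A) →
      Deriv Γ Δ (.lapp s t) (.comp B)

/-- The equational theory of EEC: the smallest type-respecting congruence
containing the βη-equalities of Figure 2 of the paper. -/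
inductive EEq : List VType → Option CType → Tm → Tm → VType → Prop
  -- equivalence
  | refl {Γ Δ t A} : Deriv Γ Δ t A → EEq Γ Δ t t A
  | symm {Γ Δ t u A} : EEq Γ Δ t u A → EEq Γ Δ u t A
  | trans {Γ Δ t u v A} : EEq Γ Δ t u A → EEq Γ Δ u v A → EEq Γ Δ t v A
  -- congruence rules
  | vpair_cong {Γ t t' u u' A B} : EEq Γ none t t' A → EEq Γ none u u' B →
      EEq Γ none (.vpair t u) (.vpair t' u') (.prod A B)
  | vfst_cong {Γ t t' A B} : EEq Γ none t t' (.prod A B) →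
      EEq Γ none (.vfst t) (.vfst t') A
  | vsnd_cong {Γ t t' A B} : EEq Γ none t t' (.prod A B) →
      EEq Γ none (.vsnd t) (.vsnd t') B
  | vlam_cong {Γ t t' A B} : EEq (A :: Γ) none t t' B →
      EEq Γ none (.vlam A t) (.vlam A t') (.arr A B)
  | vapp_cong {Γ s s' t t' A B} : EEq Γ none s s' (.arr A B) → EEq Γ none t t' A →
      EEq Γ none (.vapp s t) (.vapp s' t') B
  | cpair_cong {Γ Δ t t' u u' A B} : EEq Γ Δ t t' (.comp A) → EEq Γ Δ u u' (.comp B) →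
      EEq Γ Δ (.cpair t u) (.cpair t' u') (.comp (.cand A B))
  | cfst_cong {Γ Δ t t' A B} : EEq Γ Δ t t' (.comp (.cand A B)) →
      EEq Γ Δ (.cfst t) (.cfst t') (.comp A)
  | csnd_cong {Γ Δ t t' A B} : EEq Γ Δ t t' (.comp (.cand A B)) →
      EEq Γ Δ (.csnd t) (.csnd t') (.comp B)
  | clam_cong {Γ Δ t t' A B} : EEq (A :: Γ) Δ t t' (.comp B) →
      EEq Γ Δ (.clam A t) (.clam A t') (.comp (.carr A B))
  | capp_cong {Γ Δ s s' t t' A B} : EEq Γ Δ s s' (.comp (.carr A B)) → EEq Γ none t t' A →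
      EEq Γ Δ (.capp s t) (.capp s' t') (.comp B)
  | ilet_cong {Γ Δ t t' u u' A} : EEq Γ Δ t t' (.comp .iunit) → EEq Γ none u u' (.comp A) →
      EEq Γ Δ (.ilet t u) (.ilet t' u') (.comp A)
  | bang_cong {Γ t t' A} : EEq Γ none t t' A →
      EEq Γ none (.bang t) (.bang t') (.comp (.bang A))
  | banglet_cong {Γ Δ t t' u u' A B} : EEq Γ Δ t t' (.comp (.bang A)) →
      EEq (A :: Γ) none u u' (.comp B) →
      EEq Γ Δ (.banglet t u) (.banglet t' u') (.comp B)
  | copow_cong {Γ Δ t t' u u' A B} : EEq Γ none t t' A → EEq Γ Δ u u' (.comp B) →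
      EEq Γ Δ (.copow t u) (.copow t' u') (.comp (.copow A B))
  | copowlet_cong {Γ Δ s s' t t' A B C} : EEq Γ Δ s s' (.comp (.copow A B)) →
      EEq (A :: Γ) (some B) t t' (.comp C) →
      EEq Γ Δ (.copowlet s t) (.copowlet s' t') (.comp C)
  | cimage_cong {Γ Δ t t' A} : EEq Γ Δ t t' (.comp .czero) →
      EEq Γ Δ (.cimage A t) (.cimage A t') (.comp A)
  | cinl_cong {Γ Δ t t' A B} : EEq Γ Δ t t' (.comp A) →
      EEq Γ Δ (.cinl t) (.cinl t') (.comp (.csum A B))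
  | cinr_cong {Γ Δ t t' A B} : EEq Γ Δ t t' (.comp B) →
      EEq Γ Δ (.cinr t) (.cinr t') (.comp (.csum A B))
  | ccase_cong {Γ Δ s s' t t' u u' A B C} : EEq Γ Δ s s' (.comp (.csum A B)) →
      EEq Γ (some A) t t' (.comp C) → EEq Γ (some B) u u' (.comp C) →
      EEq Γ Δ (.ccase s t u) (.ccase s' t' u') (.comp C)
  | llam_cong {Γ t t' A B} : EEq Γ (some A) t t' (.comp B) →
      EEq Γ none (.llam A t) (.llam A t') (.lin A B)
  | lapp_cong {Γ Δ s s' t t' A B} : EEq Γ none s s' (.lin A B) → EEq Γ Δ t t' (.comp A) →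
      EEq Γ Δ (.lapp s t) (.lapp s' t') (.comp B)
  -- the equalities of Figure 2
  | unit_eta {Γ t} : Deriv Γ none t .unit → EEq Γ none t .unit .unit
  | vfst_beta {Γ t u A B} : Deriv Γ none t A → Deriv Γ none u B →
      EEq Γ none (.vfst (.vpair t u)) t A
  | vsnd_beta {Γ t u A B} : Deriv Γ none t A → Deriv Γ none u B →
      EEq Γ none (.vsnd (.vpair t u)) u B
  | vpair_eta {Γ t A B} : Deriv Γ none t (.prod A B) →
      EEq Γ none (.vpair (.vfst t) (.vsnd t)) t (.prod A B)
  | vlam_beta {Γ t u A B} : Deriv (A :: Γ) none t B → Deriv Γ none u A →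
      EEq Γ none (.vapp (.vlam A t) u) (Tm.subst0 u t) B
  | vlam_eta {Γ t A B} : Deriv Γ none t (.arr A B) →
      EEq Γ none (.vlam A (.vapp (Tm.shift t) (.var 0))) t (.arr A B)
  | cunit_eta {Γ Δ t} : Deriv Γ Δ t (.comp .cunit) → EEq Γ Δ t .cunit (.comp .cunit)
  | cfst_beta {Γ Δ t u A B} : Deriv Γ Δ t (.comp A) → Deriv Γ Δ u (.comp B) →
      EEq Γ Δ (.cfst (.cpair t u)) t (.comp A)
  | csnd_beta {Γ Δ t u A B} : Deriv Γ Δ t (.comp A) → Deriv Γ Δ u (.comp B) →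
      EEq Γ Δ (.csnd (.cpair t u)) u (.comp B)
  | cpair_eta {Γ Δ t A B} : Deriv Γ Δ t (.comp (.cand A B)) →
      EEq Γ Δ (.cpair (.cfst t) (.csnd t)) t (.comp (.cand A B))
  | clam_beta {Γ Δ t u A B} : Deriv (A :: Γ) Δ t (.comp B) → Deriv Γ none u A →
      EEq Γ Δ (.capp (.clam A t) u) (Tm.subst0 u t) (.comp B)
  | clam_eta {Γ Δ t A B} : Deriv Γ Δ t (.comp (.carr A B)) →
      EEq Γ Δ (.clam A (.capp (Tm.shift t) (.var 0))) t (.comp (.carr A B))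
  | ilet_beta {Γ t A} : Deriv Γ none t (.comp A) →
      EEq Γ none (.ilet .top t) t (.comp A)
  | ilet_eta {Γ Δ t u A} : Deriv Γ Δ t (.comp .iunit) → Deriv Γ (some .iunit) u (.comp A) →
      EEq Γ Δ (.ilet t (Tm.ssubst .top u)) (Tm.ssubst t u) (.comp A)
  | bang_beta {Γ t u A B} : Deriv Γ none t A → Deriv (A :: Γ) none u (.comp B) →
      EEq Γ none (.banglet (.bang t) u) (Tm.subst0 t u) (.comp B)
  | bang_eta {Γ Δ t u A B} : Deriv Γ Δ t (.comp (.bang A)) →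
      Deriv Γ (some (.bang A)) u (.comp B) →
      EEq Γ Δ (.banglet t (Tm.ssubst (.bang (.var 0)) (Tm.shift u))) (Tm.ssubst t u) (.comp B)
  | copow_beta {Γ Δ t s u A B C} : Deriv Γ none t A → Deriv Γ Δ s (.comp B) →
      Deriv (A :: Γ) (some B) u (.comp C) →
      EEq Γ Δ (.copowlet (.copow t s) u) (Tm.ssubst s (Tm.subst0 t u)) (.comp C)
  | copow_eta {Γ Δ t u A B C} : Deriv Γ Δ t (.comp (.copow A B)) →
      Deriv Γ (some (.copow A B)) u (.comp C) →
      EEq Γ Δ (.copowlet t (Tm.ssubst (.copow (.var 0) .svar) (Tm.shift u))) (Tm.ssubst t u) (.comp C)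
  | czero_eta {Γ Δ t u A} : Deriv Γ Δ t (.comp .czero) → Deriv Γ (some .czero) u (.comp A) →
      EEq Γ Δ (.cimage A t) (Tm.ssubst t u) (.comp A)
  | csum_beta_inl {Γ Δ t u u' A B C} : Deriv Γ (some A) u (.comp C) →
      Deriv Γ (some B) u' (.comp C) → Deriv Γ Δ t (.comp A) →
      EEq Γ Δ (.ccase (.cinl t) u u') (Tm.ssubst t u) (.comp C)
  | csum_beta_inr {Γ Δ t u u' A B C} : Deriv Γ (some A) u (.comp C) →
      Deriv Γ (some B) u' (.comp C) → Deriv Γ Δ t (.comp B) →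
      EEq Γ Δ (.ccase (.cinr t) u u') (Tm.ssubst t u') (.comp C)
  | csum_eta {Γ Δ t u A B C} : Deriv Γ Δ t (.comp (.csum A B)) →
      Deriv Γ (some (.csum A B)) u (.comp C) →
      EEq Γ Δ (.ccase t (Tm.ssubst (.cinl .svar) u) (Tm.ssubst (.cinr .svar) u)) (Tm.ssubst t u) (.comp C)
  | llam_beta {Γ Δ t u A B} : Deriv Γ (some A) t (.comp B) → Deriv Γ Δ u (.comp A) →
      EEq Γ Δ (.lapp (.llam A t) u) (Tm.ssubst u t) (.comp B)
  | llam_eta {Γ t A B} : Deriv Γ none t (.lin A B) →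
      EEq Γ none (.llam A (.lapp t .svar)) t (.lin A B)

end EEC

namespace EEC

/-! ## The generic linear-use CPS self-translation of EEC (Figures 4–6) -/

mutual
  /-- CPS translation `Aᶜ` of value types, relative to the result type `R̲`. -/
  def cpsV (R : CType) : VType → VType
    | .base a => .base a
    | .unit => .unit
    | .prod A B => .prod (cpsV R A) (cpsV R B)
    | .arr A B => .arr (cpsV R A) (cpsV R B)
    | .comp A => .lin (cpsC R A) R
    | .lin A B => .lin (cpsC R B) (cpsC R A)
  /-- CPS translation `A̲ᶜ` of computation types, relative to the result type
  `R̲` (a computation-type constant equal to `R̲` is translated to `I̲`). -/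
  def cpsC (R : CType) : CType → CType
    | .base a =>
        match R with
        | .base b => if b = a then .iunit else .base a
        | _ => .base a
    | .cunit => .czero
    | .cand A B => .csum (cpsC R A) (cpsC R B)
    | .carr A B => .copow (cpsV R A) (cpsC R B)
    | .iunit => R
    | .bang A => .carr (cpsV R A) R
    | .copow A B => .carr (cpsV R A) (cpsC R B)
    | .czero => .cunit
    | .csum A B => .cand (cpsC R A) (cpsC R B)
end

/-- Pointwise CPS translation `Γᶜ` of a context. -/
def cpsCtx (R : CType) (Γ : List VType) : List VType := Γ.map (cpsV R)

/-- The generic linear-use CPS self-translation on terms (Figures 5 and 6 of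
the paper), defined by recursion on typing derivations.  A value judgement
`Γ ⊢ t : A` is sent to a term `tᶜ` with `Γᶜ ⊢ tᶜ : Aᶜ`, and a stoup
judgement `Γ | z:A̲ ⊢ t : B̲` is sent (contravariantly) to a term `tᶜ` with
`Γᶜ | k_z:B̲ᶜ ⊢ tᶜ : A̲ᶜ`. -/
def cps (R : CType) : {Γ : List VType} → {Δ : Option CType} → {t : Tm} → {A : VType} →
    Deriv Γ Δ t A → Tm
  | _, _, _, _, .var _ n _ _ => .var n
  | _, _, _, _, .svar _ _ => .svar
  | _, _, _, _, .unit _ => .unit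
  | _, _, _, _, .vpair _ _ _ _ _ d1 d2 => .vpair (cps R d1) (cps R d2)
  | _, _, _, _, .vfst _ _ _ _ d => .vfst (cps R d)
  | _, _, _, _, .vsnd _ _ _ _ d => .vsnd (cps R d)
  | _, _, _, _, .vlam _ _ A _ d => .vlam (cpsV R A) (cps R d)
  | _, _, _, _, .vapp _ _ _ _ _ d1 d2 => .vapp (cps R d1) (cps R d2)
  | _, _, _, _, .cunit _ none => .llam .czero (.cimage R .svar)
  | _, _, _, _, .cunit _ (some D) => .cimage (cpsC R D) .svar
  | _, _, _, _, .cpair _ none _ _ A B d1 d2 =>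
      .llam (.csum (cpsC R A) (cpsC R B))
        (.ccase .svar (.lapp (cps R d1) .svar) (.lapp (cps R d2) .svar))
  | _, _, _, _, .cpair _ (some _) _ _ _ _ d1 d2 => .ccase .svar (cps R d1) (cps R d2)
  | _, _, _, _, .cfst _ none _ A _ d => .llam (cpsC R A) (.lapp (cps R d) (.cinl .svar))
  | _, _, _, _, .cfst _ (some _) _ _ _ d => Tm.ssubst (.cinl .svar) (cps R d)
  | _, _, _, _, .csnd _ none _ _ B d => .llam (cpsC R B) (.lapp (cps R d) (.cinr .svar))
  | _, _, _, _, .csnd _ (some _) _ _ _ d => Tm.ssubst (.cinr .svar) (cps R d)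
  | _, _, _, _, .clam _ none _ A B d =>
      .llam (.copow (cpsV R A) (cpsC R B)) (.copowlet .svar (.lapp (cps R d) .svar))
  | _, _, _, _, .clam _ (some _) _ _ _ d => .copowlet .svar (cps R d)
  | _, _, _, _, .capp _ none _ _ _ B d1 d2 =>
      .llam (cpsC R B) (.lapp (cps R d1) (.copow (cps R d2) .svar))
  | _, _, _, _, .capp _ (some _) _ _ _ _ d1 d2 =>
      Tm.ssubst (.copow (cps R d2) .svar) (cps R d1)
  | _, _, _, _, .top _ => .llam R .svar
  | _, _, _, _, .ilet _ none _ _ A d1 d2 =>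
      .llam (cpsC R A) (.lapp (cps R d1) (.lapp (cps R d2) .svar))
  | _, _, _, _, .ilet _ (some _) _ _ _ d1 d2 =>
      Tm.ssubst (.lapp (cps R d2) .svar) (cps R d1)
  | _, _, _, _, .bang _ _ A d => .llam (.carr (cpsV R A) R) (.capp .svar (cps R d))
  | _, _, _, _, .banglet _ none _ _ A B d1 d2 =>
      .llam (cpsC R B) (.lapp (cps R d1) (.clam (cpsV R A) (.lapp (cps R d2) .svar)))
  | _, _, _, _, .banglet _ (some _) _ _ A _ d1 d2 =>
      Tm.ssubst (.clam (cpsV R A) (.lapp (cps R d2) .svar)) (cps R d1)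
  | _, _, _, _, .copow _ none _ _ A B d1 d2 =>
      .llam (.carr (cpsV R A) (cpsC R B)) (.lapp (cps R d2) (.capp .svar (cps R d1)))
  | _, _, _, _, .copow _ (some _) _ _ _ _ d1 d2 =>
      Tm.ssubst (.capp .svar (cps R d1)) (cps R d2)
  | _, _, _, _, .copowlet _ none _ _ A _ C d1 d2 =>
      .llam (cpsC R C) (.lapp (cps R d1) (.clam (cpsV R A) (cps R d2)))
  | _, _, _, _, .copowlet _ (some _) _ _ A _ _ d1 d2 =>
      Tm.ssubst (.clam (cpsV R A) (cps R d2)) (cps R d1)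
  | _, _, _, _, .cimage _ none _ A d => .llam (cpsC R A) (.lapp (cps R d) .cunit)
  | _, _, _, _, .cimage _ (some _) _ _ d => Tm.ssubst .cunit (cps R d)
  | _, _, _, _, .cinl _ none _ A B d =>
      .llam (.cand (cpsC R A) (cpsC R B)) (.lapp (cps R d) (.cfst .svar))
  | _, _, _, _, .cinl _ (some _) _ _ _ d => Tm.ssubst (.cfst .svar) (cps R d)
  | _, _, _, _, .cinr _ none _ A B d =>
      .llam (.cand (cpsC R A) (cpsC R B)) (.lapp (cps R d) (.csnd .svar))
  | _, _, _, _, .cinr _ (some _) _ _ _ d => Tm.ssubst (.csnd .svar) (cps R d)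
  | _, _, _, _, .ccase _ none _ _ _ _ _ C d1 d2 d3 =>
      .llam (cpsC R C) (.lapp (cps R d1) (.cpair (cps R d2) (cps R d3)))
  | _, _, _, _, .ccase _ (some _) _ _ _ _ _ _ d1 d2 d3 =>
      Tm.ssubst (.cpair (cps R d2) (cps R d3)) (cps R d1)
  | _, _, _, _, .llam _ _ _ B d => .llam (cpsC R B) (cps R d)
  | _, _, _, _, .lapp _ none _ _ _ B d1 d2 =>
      .llam (cpsC R B) (.lapp (cps R d2) (.lapp (cps R d1) .svar))
  | _, _, _, _, .lapp _ (some _) _ _ _ _ d1 d2 =>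
      Tm.ssubst (.lapp (cps R d1) .svar) (cps R d2)

end EEC

namespace EEC

/-! ## The type isomorphisms `ι` of Figure 7, with explicit inverses -/

mutual
  /-- The closed term `ι_A : (Aᶜ)ᶜ → A` (Figure 7). -/
  def iotaV (R : CType) : VType → Tm
    | .base a => .vlam (.base a) (.var 0)
    | .unit => .vlam .unit .unit
    | .prod A B => .vlam (cpsV R (cpsV R (.prod A B)))
        (.vpair (.vapp (iotaV R A) (.vfst (.var 0))) (.vapp (iotaV R B) (.vsnd (.var 0))))
    | .arr A B => .vlam (cpsV R (cpsV R (.arr A B)))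
        (.vlam A (.vapp (iotaV R B) (.vapp (.var 1) (.vapp (iotaVinv R A) (.var 0)))))
    | .comp A => .vlam (cpsV R (cpsV R (.comp A)))
        (.lapp (iotaC R A) (.lapp (.var 0) .top))
    | .lin A B => .vlam (cpsV R (cpsV R (.lin A B)))
        (.llam A (.lapp (iotaC R B) (.lapp (.var 0) (.lapp (iotaCinv R A) .svar))))
  /-- The closed term `ι_A⁻¹ : A → (Aᶜ)ᶜ`. -/
  def iotaVinv (R : CType) : VType → Tm
    | .base a => .vlam (.base a) (.var 0)
    | .unit => .vlam .unit .unit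
    | .prod A B => .vlam (.prod A B)
        (.vpair (.vapp (iotaVinv R A) (.vfst (.var 0))) (.vapp (iotaVinv R B) (.vsnd (.var 0))))
    | .arr A B => .vlam (.arr A B)
        (.vlam (cpsV R (cpsV R A)) (.vapp (iotaVinv R B) (.vapp (.var 1) (.vapp (iotaV R A) (.var 0)))))
    | .comp A => .vlam (.comp A)
        (.llam .iunit (.ilet .svar (.lapp (iotaCinv R A) (.var 0))))
    | .lin A B => .vlam (.lin A B)
        (.llam (cpsC R (cpsC R A)) (.lapp (iotaCinv R B) (.lapp (.var 0) (.lapp (iotaC R A) .svar))))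
  /-- The closed term `ι_A̲ : (A̲ᶜ)ᶜ ⊸ A̲` (Figure 7). -/
  def iotaC (R : CType) : CType → Tm
    | .base a => .llam (cpsC R (cpsC R (.base a))) .svar
    | .cunit => .llam (cpsC R (cpsC R .cunit)) .cunit
    | .cand A B => .llam (cpsC R (cpsC R (.cand A B)))
        (.cpair (.lapp (iotaC R A) (.cfst .svar)) (.lapp (iotaC R B) (.csnd .svar)))
    | .carr A B => .llam (cpsC R (cpsC R (.carr A B)))
        (.clam A (.lapp (iotaC R B) (.capp .svar (.vapp (iotaVinv R A) (.var 0)))))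
    | .iunit => .llam (cpsC R (cpsC R .iunit)) .svar
    | .bang A => .llam (cpsC R (cpsC R (.bang A)))
        (.copowlet .svar (.ilet .svar (.bang (.vapp (iotaV R A) (.var 0)))))
    | .copow A B => .llam (cpsC R (cpsC R (.copow A B)))
        (.copowlet .svar (.copow (.vapp (iotaV R A) (.var 0)) (.lapp (iotaC R B) .svar)))
    | .czero => .llam (cpsC R (cpsC R .czero)) .svar
    | .csum A B => .llam (cpsC R (cpsC R (.csum A B)))
        (.ccase .svar (.cinl (.lapp (iotaC R A) .svar)) (.cinr (.lapp (iotaC R B) .svar)))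
  /-- The closed term `ι_A̲⁻¹ : A̲ ⊸ (A̲ᶜ)ᶜ`. -/
  def iotaCinv (R : CType) : CType → Tm
    | .base a => .llam (.base a) .svar
    | .cunit => .llam .cunit .cunit
    | .cand A B => .llam (.cand A B)
        (.cpair (.lapp (iotaCinv R A) (.cfst .svar)) (.lapp (iotaCinv R B) (.csnd .svar)))
    | .carr A B => .llam (.carr A B)
        (.clam (cpsV R (cpsV R A)) (.lapp (iotaCinv R B) (.capp .svar (.vapp (iotaV R A) (.var 0)))))
    | .iunit => .llam .iunit .svar
    | .bang A => .llam (.bang A)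
        (.banglet .svar (.copow (.vapp (iotaVinv R A) (.var 0)) .top))
    | .copow A B => .llam (.copow A B)
        (.copowlet .svar (.copow (.vapp (iotaVinv R A) (.var 0)) (.lapp (iotaCinv R B) .svar)))
    | .czero => .llam .czero .svar
    | .csum A B => .llam (.csum A B)
        (.ccase .svar (.cinl (.lapp (iotaCinv R A) .svar)) (.cinr (.lapp (iotaCinv R B) .svar)))
end

/-- The substitution `[ι⁻¹(Γ)]`, replacing each variable `xᵢ : Cᵢ` of `Γ` by
`ι_{Cᵢ}⁻¹(xᵢ)`. -/
def iotaSubst (R : CType) (Γ : List VType) (t : Tm) : Tm :=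
  Tm.psubst (fun n =>
    match Γ[n]? with
    | some C => .vapp (iotaVinv R C) (.var n)
    | none => .var n) t

/-! ## The simply-typed λ-calculus -/

/-- Simple types. -/
inductive STy : Type
  | base : ℕ → STy
  | unit : STy
  | prod : STy → STy → STy
  | arr : STy → STy → STy

/-- Raw simply-typed λ-terms (de Bruijn indices). -/
inductive LTm : Type
  | var : ℕ → LTm
  | unit : LTm
  | pair : LTm → LTm → LTm
  | fst : LTm → LTm
  | snd : LTm → LTm
  | lam : STy → LTm → LTm
  | app : LTm → LTm → LTm

namespace LTm

/-- Renaming of variables. -/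
def rename (f : ℕ → ℕ) : LTm → LTm
  | .var n => .var (f n)
  | .unit => .unit
  | .pair M N => .pair (rename f M) (rename f N)
  | .fst M => .fst (rename f M)
  | .snd M => .snd (rename f M)
  | .lam σ M => .lam σ (rename (Tm.liftN f) M)
  | .app M N => .app (rename f M) (rename f N)

/-- Weakening. -/
def shift (M : LTm) : LTm := rename Nat.succ M

/-- Parallel capture-avoiding substitution. -/
def psubst (σ : ℕ → LTm) : LTm → LTm
  | .var n => σ n
  | .unit => .unit
  | .pair M N => .pair (psubst σ M) (psubst σ N)
  | .fst M => .fst (psubst σ M)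
  | .snd M => .snd (psubst σ M)
  | .lam τ M => .lam τ (psubst (fun n => match n with | 0 => .var 0 | m + 1 => shift (σ m)) M)
  | .app M N => .app (psubst σ M) (psubst σ N)

/-- Capture-avoiding substitution `M[N/x]` for the innermost variable. -/
def subst0 (N : LTm) (M : LTm) : LTm :=
  psubst (fun n => match n with | 0 => N | m + 1 => .var m) M

end LTm

/-- Typing derivations of the simply-typed λ-calculus (Figure 3). -/
inductive LDeriv : List STy → LTm → STy → Type
  | var (Θ : List STy) (n : ℕ) (σ : STy) : Θ[n]? = some σ → LDeriv Θ (.var n) σ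
  | unit (Θ : List STy) : LDeriv Θ .unit .unit
  | pair (Θ : List STy) (M N : LTm) (σ τ : STy) :
      LDeriv Θ M σ → LDeriv Θ N τ → LDeriv Θ (.pair M N) (.prod σ τ)
  | fst (Θ : List STy) (M : LTm) (σ τ : STy) :
      LDeriv Θ M (.prod σ τ) → LDeriv Θ (.fst M) σ
  | snd (Θ : List STy) (M : LTm) (σ τ : STy) :
      LDeriv Θ M (.prod σ τ) → LDeriv Θ (.snd M) τ
  | lam (Θ : List STy) (M : LTm) (σ τ : STy) :
      LDeriv (σ :: Θ) M τ → LDeriv Θ (.lam σ M) (.arr σ τ)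
  | app (Θ : List STy) (M N : LTm) (σ τ : STy) :
      LDeriv Θ M (.arr σ τ) → LDeriv Θ N σ → LDeriv Θ (.app M N) τ

/-- Values of the (call-by-value) λ-calculus. -/
inductive LVal : LTm → Prop
  | var (n : ℕ) : LVal (.var n)
  | unit : LVal .unit
  | lam (σ : STy) (M : LTm) : LVal (.lam σ M)
  | pair {M N : LTm} : LVal M → LVal N → LVal (.pair M N)

/-- βη-equality of the simply-typed λ-calculus. -/
inductive LBetaEta : List STy → LTm → LTm → STy → Prop
  | refl {Θ M σ} : LDeriv Θ M σ → LBetaEta Θ M M σ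
  | symm {Θ M N σ} : LBetaEta Θ M N σ → LBetaEta Θ N M σ
  | trans {Θ M N P σ} : LBetaEta Θ M N σ → LBetaEta Θ N P σ → LBetaEta Θ M P σ
  | pair_cong {Θ M M' N N' σ τ} : LBetaEta Θ M M' σ → LBetaEta Θ N N' τ →
      LBetaEta Θ (.pair M N) (.pair M' N') (.prod σ τ)
  | fst_cong {Θ M M' σ τ} : LBetaEta Θ M M' (.prod σ τ) → LBetaEta Θ (.fst M) (.fst M') σ
  | snd_cong {Θ M M' σ τ} : LBetaEta Θ M M' (.prod σ τ) → LBetaEta Θ (.snd M) (.snd M') τ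
  | lam_cong {Θ M M' σ τ} : LBetaEta (σ :: Θ) M M' τ →
      LBetaEta Θ (.lam σ M) (.lam σ M') (.arr σ τ)
  | app_cong {Θ M M' N N' σ τ} : LBetaEta Θ M M' (.arr σ τ) → LBetaEta Θ N N' σ →
      LBetaEta Θ (.app M N) (.app M' N') τ
  | beta {Θ M N σ τ} : LDeriv (σ :: Θ) M τ → LDeriv Θ N σ →
      LBetaEta Θ (.app (.lam σ M) N) (LTm.subst0 N M) τ
  | eta {Θ M σ τ} : LDeriv Θ M (.arr σ τ) →
      LBetaEta Θ (.lam σ (.app (LTm.shift M) (.var 0))) M (.arr σ τ)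
  | fst_beta {Θ M N σ τ} : LDeriv Θ M σ → LDeriv Θ N τ →
      LBetaEta Θ (.fst (.pair M N)) M σ
  | snd_beta {Θ M N σ τ} : LDeriv Θ M σ → LDeriv Θ N τ →
      LBetaEta Θ (.snd (.pair M N)) N τ
  | pair_eta {Θ M σ τ} : LDeriv Θ M (.prod σ τ) →
      LBetaEta Θ (.pair (.fst M) (.snd M)) M (.prod σ τ)
  | unit_eta {Θ M} : LDeriv Θ M .unit → LBetaEta Θ M .unit .unit

/-- Equality in Moggi's computational λ-calculus `λc` (call-by-value
βη-equalities restricted to values, together with the `let`-laws, expressed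
via the standard encoding `let x = M in N := (λx.N) M`). -/
inductive LamC : List STy → LTm → LTm → STy → Prop
  | refl {Θ M σ} : LDeriv Θ M σ → LamC Θ M M σ
  | symm {Θ M N σ} : LamC Θ M N σ → LamC Θ N M σ
  | trans {Θ M N P σ} : LamC Θ M N σ → LamC Θ N P σ → LamC Θ M P σ
  | pair_cong {Θ M M' N N' σ τ} : LamC Θ M M' σ → LamC Θ N N' τ →
      LamC Θ (.pair M N) (.pair M' N') (.prod σ τ)
  | fst_cong {Θ M M' σ τ} : LamC Θ M M' (.prod σ τ) → LamC Θ (.fst M) (.fst M') σ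
  | snd_cong {Θ M M' σ τ} : LamC Θ M M' (.prod σ τ) → LamC Θ (.snd M) (.snd M') τ
  | lam_cong {Θ M M' σ τ} : LamC (σ :: Θ) M M' τ →
      LamC Θ (.lam σ M) (.lam σ M') (.arr σ τ)
  | app_cong {Θ M M' N N' σ τ} : LamC Θ M M' (.arr σ τ) → LamC Θ N N' σ →
      LamC Θ (.app M N) (.app M' N') τ
  | beta_v {Θ M V σ τ} : LDeriv (σ :: Θ) M τ → LDeriv Θ V σ → LVal V →
      LamC Θ (.app (.lam σ M) V) (LTm.subst0 V M) τ
  | eta_v {Θ V σ τ} : LVal V → LDeriv Θ V (.arr σ τ) →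
      LamC Θ (.lam σ (.app (LTm.shift V) (.var 0))) V (.arr σ τ)
  | fst_beta_v {Θ V W σ τ} : LVal V → LVal W → LDeriv Θ V σ → LDeriv Θ W τ →
      LamC Θ (.fst (.pair V W)) V σ
  | snd_beta_v {Θ V W σ τ} : LVal V → LVal W → LDeriv Θ V σ → LDeriv Θ W τ →
      LamC Θ (.snd (.pair V W)) W τ
  | pair_eta_v {Θ V σ τ} : LVal V → LDeriv Θ V (.prod σ τ) →
      LamC Θ (.pair (.fst V) (.snd V)) V (.prod σ τ)
  | unit_eta_v {Θ V} : LVal V → LDeriv Θ V .unit → LamC Θ V .unit .unit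
  | let_eta {Θ M σ} : LDeriv Θ M σ → LamC Θ (.app (.lam σ (.var 0)) M) M σ
  | let_assoc {Θ M N L σ ρ τ} : LDeriv (σ :: Θ) M τ → LDeriv (ρ :: Θ) N σ →
      LDeriv Θ L ρ →
      LamC Θ (.app (.lam σ M) (.app (.lam ρ N) L))
        (.app (.lam ρ (.app (.lam σ (LTm.rename (Tm.liftN Nat.succ) M)) N)) L) τ
  | app_left {Θ M N σ τ} : LDeriv Θ M (.arr σ τ) → LDeriv Θ N σ →
      LamC Θ (.app M N) (.app (.lam (.arr σ τ) (.app (.var 0) (LTm.shift N))) M) τ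
  | app_right {Θ V N σ τ} : LVal V → LDeriv Θ V (.arr σ τ) → LDeriv Θ N σ →
      LamC Θ (.app V N) (.app (.lam σ (.app (LTm.shift V) (.var 0))) N) τ
  | pair_left {Θ M N σ τ} : LDeriv Θ M σ → LDeriv Θ N τ →
      LamC Θ (.pair M N) (.app (.lam σ (.pair (.var 0) (LTm.shift N))) M) (.prod σ τ)
  | pair_right {Θ V N σ τ} : LVal V → LDeriv Θ V σ → LDeriv Θ N τ →
      LamC Θ (.pair V N) (.app (.lam τ (.pair (LTm.shift V) (.var 0))) N) (.prod σ τ)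
  | fst_cc {Θ M σ τ} : LDeriv Θ M (.prod σ τ) →
      LamC Θ (.fst M) (.app (.lam (.prod σ τ) (.fst (.var 0))) M) σ
  | snd_cc {Θ M σ τ} : LDeriv Θ M (.prod σ τ) →
      LamC Θ (.snd M) (.app (.lam (.prod σ τ) (.snd (.var 0))) M) τ

end EEC

namespace EEC

/-! ## The standard cbv and cbn translations of typed λ-calculus into EEC -/

/-- The computation-type constant `α̲` associated with a simply-typed
λ-calculus type constant `α` (the association is injective but not
surjective, so that some computation-type constants of EEC are different
from `α̲` for every λ-calculus type constant `α`). -/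
def assocC (a : ℕ) : CType := .base (a + 1)

/-- The call-by-value translation `σᵛ` on types. -/
def cbvT : STy → VType
  | .base a => .base a
  | .unit => .unit
  | .prod σ τ => .prod (cbvT σ) (cbvT τ)
  | .arr σ τ => .arr (cbvT σ) (.comp (.bang (cbvT τ)))

/-- The call-by-value translation `Θᵛ` on contexts. -/
def cbvCtx (Θ : List STy) : List VType := Θ.map cbvT

/-- The call-by-value translation on terms: `Θ ⊢ M : τ` is sent to
`Θᵛ ⊢ Mᵛ : !(τᵛ)`. -/
def cbvTm : LTm → Tm
  | .var n => .bang (.var n)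
  | .unit => .bang .unit
  | .pair M N => .banglet (cbvTm M) (.banglet (Tm.shift (cbvTm N)) (.bang (.vpair (.var 1) (.var 0))))
  | .fst M => .banglet (cbvTm M) (.bang (.vfst (.var 0)))
  | .snd M => .banglet (cbvTm M) (.bang (.vsnd (.var 0)))
  | .lam σ M => .bang (.vlam (cbvT σ) (cbvTm M))
  | .app M N => .banglet (cbvTm M) (.banglet (Tm.shift (cbvTm N)) (.vapp (.var 1) (.var 0)))

/-- The call-by-name translation `σⁿ` on types. -/
def cbnT : STy → CType
  | .base a => assocC a
  | .unit => .cunit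
  | .prod σ τ => .cand (cbnT σ) (cbnT τ)
  | .arr σ τ => .carr (.comp (cbnT σ)) (cbnT τ)

/-- The call-by-name translation `Θⁿ` on contexts. -/
def cbnCtx (Θ : List STy) : List VType := Θ.map (fun σ => .comp (cbnT σ))

/-- The call-by-name translation on terms: `Θ ⊢ M : τ` is sent to
`Θⁿ ⊢ Mⁿ : τⁿ`, mimicking each construct by the corresponding
computation-type construct of EEC. -/
def cbnTm : LTm → Tm
  | .var n => .var n
  | .unit => .cunit
  | .pair M N => .cpair (cbnTm M) (cbnTm N)
  | .fst M => .cfst (cbnTm M)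
  | .snd M => .csnd (cbnTm M)
  | .lam σ M => .clam (.comp (cbnT σ)) (cbnTm M)
  | .app M N => .capp (cbnTm M) (cbnTm N)

/-! ## Hasegawa's linear-use CPS translations (Section 4) -/

/-- The call-by-value linear-use CPS translation `σᵛᶜ` on types. -/
def cbvcpsT (R : CType) : STy → VType
  | .base a => .base a
  | .unit => .unit
  | .prod σ τ => .prod (cbvcpsT R σ) (cbvcpsT R τ)
  | .arr σ τ => .arr (cbvcpsT R σ) (.lin (.carr (cbvcpsT R τ) R) R)

/-- `Θᵛᶜ`. -/
def cbvcpsCtx (R : CType) (Θ : List STy) : List VType := Θ.map (cbvcpsT R)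

/-- The call-by-value linear-use CPS translation on terms: `Θ ⊢ M : τ` is
sent to `Θᵛᶜ ⊢ Mᵛᶜ : (τᵛᶜ ⇒ R̲) ⊸ R̲`. -/
def cbvcps (R : CType) : {Θ : List STy} → {M : LTm} → {σ : STy} → LDeriv Θ M σ → Tm
  | _, _, _, .var _ n σ _ => .llam (.carr (cbvcpsT R σ) R) (.capp .svar (.var n))
  | _, _, _, .unit _ => .llam (.carr .unit R) (.capp .svar .unit)
  | _, _, _, .pair _ _ _ σ τ dM dN =>
      .llam (.carr (.prod (cbvcpsT R σ) (cbvcpsT R τ)) R)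
        (.lapp (cbvcps R dM)
          (.clam (cbvcpsT R σ)
            (.lapp (Tm.shift (cbvcps R dN))
              (.clam (cbvcpsT R τ) (.capp .svar (.vpair (.var 1) (.var 0)))))))
  | _, _, _, .fst _ _ σ τ dM =>
      .llam (.carr (cbvcpsT R σ) R)
        (.lapp (cbvcps R dM)
          (.clam (.prod (cbvcpsT R σ) (cbvcpsT R τ)) (.capp .svar (.vfst (.var 0)))))
  | _, _, _, .snd _ _ σ τ dM =>
      .llam (.carr (cbvcpsT R τ) R)
        (.lapp (cbvcps R dM)
          (.clam (.prod (cbvcpsT R σ) (cbvcpsT R τ)) (.capp .svar (.vsnd (.var 0)))))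
  | _, _, _, .lam _ _ σ τ dM =>
      .llam (.carr (.arr (cbvcpsT R σ) (.lin (.carr (cbvcpsT R τ) R) R)) R)
        (.capp .svar (.vlam (cbvcpsT R σ) (cbvcps R dM)))
  | _, _, _, .app _ _ _ σ τ dM dN =>
      .llam (.carr (cbvcpsT R τ) R)
        (.lapp (cbvcps R dM)
          (.clam (.arr (cbvcpsT R σ) (.lin (.carr (cbvcpsT R τ) R) R))
            (.lapp (Tm.shift (cbvcps R dN))
              (.clam (cbvcpsT R σ) (.lapp (.vapp (.var 1) (.var 0)) .svar)))))

/-- The call-by-name linear-use CPS translation `σⁿᶜ` on types. -/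
def cbncpsT (R : CType) : STy → CType
  | .base a => assocC a
  | .unit => .czero
  | .prod σ τ => .csum (cbncpsT R σ) (cbncpsT R τ)
  | .arr σ τ => .copow (.lin (cbncpsT R σ) R) (cbncpsT R τ)

/-- `Θⁿᶜ ⊸ R̲`, assigning each variable `xᵢ : σᵢ` the type `σᵢⁿᶜ ⊸ R̲`. -/
def cbncpsCtx (R : CType) (Θ : List STy) : List VType :=
  Θ.map (fun σ => .lin (cbncpsT R σ) R)

/-- The call-by-name linear-use CPS translation on terms: `Θ ⊢ M : τ` is
sent to `Θⁿᶜ ⊸ R̲ ⊢ Mⁿᶜ : τⁿᶜ ⊸ R̲`. -/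
def cbncps (R : CType) : {Θ : List STy} → {M : LTm} → {σ : STy} → LDeriv Θ M σ → Tm
  | _, _, _, .var _ n _ _ => .var n
  | _, _, _, .unit _ => .llam .czero (.cimage R .svar)
  | _, _, _, .pair _ _ _ σ τ dM dN =>
      .llam (.csum (cbncpsT R σ) (cbncpsT R τ))
        (.ccase .svar (.lapp (cbncps R dM) .svar) (.lapp (cbncps R dN) .svar))
  | _, _, _, .fst _ _ σ _τ dM => .llam (cbncpsT R σ) (.lapp (cbncps R dM) (.cinl .svar))
  | _, _, _, .snd _ _ _ τ dM => .llam (cbncpsT R τ) (.lapp (cbncps R dM) (.cinr .svar))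
  | _, _, _, .lam _ _ σ τ dM =>
      .llam (.copow (.lin (cbncpsT R σ) R) (cbncpsT R τ))
        (.copowlet .svar (.lapp (cbncps R dM) .svar))
  | _, _, _, .app _ _ _ σ τ dM dN =>
      .llam (cbncpsT R τ) (.lapp (cbncps R dM) (.copow (cbncps R dN) .svar))

end EEC

namespace EEC

theorem Tm.liftN_comp (f g : ℕ → ℕ) :
    Tm.liftN f ∘ Tm.liftN g = Tm.liftN (f ∘ g) := by
  funext n; cases n <;> rfl

theorem Tm.liftN_id : Tm.liftN id = id := by
  funext n; cases n <;> rfl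

theorem Tm.rename_rename (t : Tm) (f g : ℕ → ℕ) :
    Tm.rename f (Tm.rename g t) = Tm.rename (f ∘ g) t := by
  induction t generalizing f g <;> simp_all [Tm.rename, Tm.liftN_comp]

theorem Tm.rename_shift (t : Tm) (f : ℕ → ℕ) :
    Tm.rename f (Tm.shift t) = Tm.rename (f ∘ Nat.succ) t :=
  Tm.rename_rename t f Nat.succ

theorem Tm.rename_id (t : Tm) : Tm.rename id t = t := by
  induction t <;> simp_all [Tm.rename, Tm.liftN_id]

theorem Tm.ssubst_svar (t : Tm) : Tm.ssubst .svar t = t := by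
  induction t <;> simp_all [Tm.ssubst, Tm.shift, Tm.rename]

theorem cbvcpsT_eq (R : CType) (σ : STy) : cbvcpsT R σ = cpsV R (cbvT σ) := by
  induction σ <;> simp_all [cbvcpsT, cbvT, cpsV, cpsC]

theorem cpsCtx_cbvCtx (R : CType) (Θ : List STy) :
    cpsCtx R (cbvCtx Θ) = cbvcpsCtx R Θ := by
  simp [cpsCtx, cbvCtx, cbvcpsCtx, cbvcpsT_eq]

theorem cpsCtx_getElem? {R : CType} {Γ : List VType} {n : ℕ} {A : VType}
    (h : Γ[n]? = some A) : (cpsCtx R Γ)[n]? = some (cpsV R A) := by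
  simp [cpsCtx, h]

/-- Applying a linear abstraction to the stoup variable recovers its body. -/
theorem EEq.lapp_llam_svar {Γ : List VType} {t u : Tm} {A B : CType}
    (h : EEq Γ (some A) u t (.comp B)) (d : Deriv Γ (some A) t (.comp B)) :
    EEq Γ (some A) u (.lapp (.llam A t) .svar) (.comp B) := by
  have e := EEq.llam_beta d (Deriv.svar Γ A)
  rw [Tm.ssubst_svar] at e
  exact h.trans e.symm

/-- Renamings of a context lift to an extended context. -/
theorem getElem?_liftN {Θ : List STy} {Γ : List VType} {f : ℕ → ℕ}
    (hf : ∀ n σ, Θ[n]? = some σ → Γ[f n]? = some (cbvT σ)) (τ : STy) :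
    ∀ n σ, (τ :: Θ)[n]? = some σ → (cbvT τ :: Γ)[Tm.liftN f n]? = some (cbvT σ) := by
  intro n σ h
  cases n with
  | zero => simpa [Tm.liftN] using congrArg (Option.map cbvT) h
  | succ n => simpa [Tm.liftN] using hf n σ (by simpa using h)

/-- The comparison of the two translations, for an arbitrary derivation of a renaming of `Mᵛ`;
the typing of the composite translation is carried along. -/
theorem cbvcps_eq_cps (R : CType) {Θ : List STy} {M : LTm} {σ : STy} (d : LDeriv Θ M σ) :
    ∀ (Γ : List VType) (f : ℕ → ℕ)
      (_ : ∀ n σ, Θ[n]? = some σ → Γ[f n]? = some (cbvT σ))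
      (t : Tm) (T : VType) (_ : t = Tm.rename f (cbvTm M)) (d' : Deriv Γ none t T),
      T = .comp (.bang (cbvT σ)) ∧
      Nonempty (Deriv (cpsCtx R Γ) none (cps R d')
        (.lin (.carr (cpsV R (cbvT σ)) R) R)) ∧
      EEq (cpsCtx R Γ) none (Tm.rename f (cbvcps R d)) (cps R d')
        (.lin (.carr (cpsV R (cbvT σ)) R) R) := by
  induction d with
  | var Θ n σ h =>
    intro Γ f hf t T ht d'
    simp only [cbvTm, Tm.rename] at ht
    subst ht
    cases d' with | bang _ _ A d' => ?_
    cases d' with | var _ _ _ h' => ?_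
    have hn := hf n σ h
    obtain rfl : cbvT σ = A := by simpa [hn] using h'
    have D : Deriv (cpsCtx R Γ) none
        (.llam (.carr (cpsV R (cbvT σ)) R) (.capp .svar (.var (f n))))
        (.lin (.carr (cpsV R (cbvT σ)) R) R) :=
      .llam _ _ _ _ (.capp _ _ _ _ _ _ (.svar _ _) (.var _ _ _ (cpsCtx_getElem? hn)))
    simp only [cps, cbvcps, Tm.rename, cbvcpsT_eq]
    exact ⟨trivial, ⟨D⟩, .refl D⟩
  | unit Θ =>
    intro Γ f hf t T ht d'
    simp only [cbvTm, Tm.rename] at ht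
    subst ht
    cases d' with | bang _ _ A d' => ?_
    cases d' with | unit _ => ?_
    have D : Deriv (cpsCtx R Γ) none (.llam (.carr .unit R) (.capp .svar .unit))
        (.lin (.carr .unit R) R) :=
      .llam _ _ _ _ (.capp _ _ _ _ _ _ (.svar _ _) (.unit _))
    simp only [cps, cbvcps, Tm.rename, cbvT, cpsV]
    exact ⟨trivial, ⟨D⟩, .refl D⟩
  | lam Θ M σ τ dM ih =>
    intro Γ f hf t T ht d'
    simp only [cbvTm, Tm.rename] at ht
    subst ht
    cases d' with | bang _ _ A d' => ?_
    cases d' with | vlam _ _ _ B d' => ?_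
    obtain ⟨rfl, ⟨D⟩, E⟩ := ih _ _ (getElem?_liftN hf σ) _ _ rfl d'
    simp only [cps, cbvcps, Tm.rename, cbvT, cpsV, cpsC, cbvcpsT_eq]
    exact ⟨trivial,
      ⟨.llam _ _ _ _ (.capp _ _ _ _ _ _ (.svar _ _) (.vlam _ _ _ _ D))⟩,
      .llam_cong (.capp_cong (.refl (.svar _ _)) (.vlam_cong E))⟩
  | fst Θ M σ τ dM ih =>
    intro Γ f hf t T ht d'
    simp only [cbvTm, Tm.rename, Tm.liftN] at ht
    subst ht
    cases d' with | banglet _ _ _ _ A B d₁ d₂ => ?_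
    cases d₂ with | bang _ _ _ d₂ => ?_
    cases d₂ with | vfst _ _ _ B d₂ => ?_
    cases d₂ with | var _ _ _ h => ?_
    obtain ⟨hA, ⟨D⟩, E⟩ := ih _ _ hf _ _ rfl d₁
    obtain rfl : A = cbvT (.prod σ τ) := by simpa using hA
    simp only [cbvT, List.getElem?_cons_zero, Option.some.injEq, VType.prod.injEq] at h
    obtain ⟨rfl, rfl⟩ := h
    simp only [cbvT, cpsV] at D E
    simp only [cps, cbvcps, Tm.rename, cbvT, cpsV, cpsC, cbvcpsT_eq, Tm.liftN]
    have K : Deriv (.prod (cpsV R (cbvT σ)) (cpsV R (cbvT τ)) :: cpsCtx R Γ)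
        (some (.carr (cpsV R (cbvT σ)) R)) (.capp .svar (.vfst (.var 0))) (.comp R) :=
      .capp _ _ _ _ _ _ (.svar _ _) (.vfst _ _ _ (cpsV R (cbvT τ)) (.var _ _ _ rfl))
    exact ⟨trivial,
      ⟨.llam _ _ _ _ (.lapp _ _ _ _ _ _ D
        (.clam _ _ _ _ _ (.lapp _ _ _ _ _ _ (.llam _ _ _ _ K) (.svar _ _))))⟩,
      .llam_cong (.lapp_cong E (.clam_cong (.lapp_llam_svar (.refl K) K)))⟩
  | snd Θ M σ τ dM ih =>
    intro Γ f hf t T ht d'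
    simp only [cbvTm, Tm.rename, Tm.liftN] at ht
    subst ht
    cases d' with | banglet _ _ _ _ A B d₁ d₂ => ?_
    cases d₂ with | bang _ _ _ d₂ => ?_
    cases d₂ with | vsnd _ _ A _ d₂ => ?_
    cases d₂ with | var _ _ _ h => ?_
    obtain ⟨hA, ⟨D⟩, E⟩ := ih _ _ hf _ _ rfl d₁
    simp only [VType.comp.injEq, CType.bang.injEq] at hA
    subst hA
    simp only [cbvT, List.getElem?_cons_zero, Option.some.injEq, VType.prod.injEq] at h
    obtain ⟨rfl, rfl⟩ := h
    simp only [cbvT, cpsV] at D E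
    simp only [cps, cbvcps, Tm.rename, cbvT, cpsV, cpsC, cbvcpsT_eq, Tm.liftN]
    have K : Deriv (.prod (cpsV R (cbvT σ)) (cpsV R (cbvT τ)) :: cpsCtx R Γ)
        (some (.carr (cpsV R (cbvT τ)) R)) (.capp .svar (.vsnd (.var 0))) (.comp R) :=
      .capp _ _ _ _ _ _ (.svar _ _) (.vsnd _ _ (cpsV R (cbvT σ)) _ (.var _ _ _ rfl))
    exact ⟨trivial,
      ⟨.llam _ _ _ _ (.lapp _ _ _ _ _ _ D
        (.clam _ _ _ _ _ (.lapp _ _ _ _ _ _ (.llam _ _ _ _ K) (.svar _ _))))⟩,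
      .llam_cong (.lapp_cong E (.clam_cong (.lapp_llam_svar (.refl K) K)))⟩
  | pair Θ M N σ τ dM dN ihM ihN =>
    intro Γ f hf t T ht d'
    simp only [cbvTm, Tm.rename, Tm.liftN, Tm.rename_shift] at ht
    subst ht
    cases d' with | banglet _ _ _ _ A B d₁ d₂ => ?_
    cases d₂ with | banglet _ _ _ _ A' _ d₂ d₃ => ?_
    cases d₃ with | bang _ _ _ d₃ => ?_
    cases d₃ with | vpair _ _ _ B B' d₃ d₄ => ?_
    cases d₃ with | var _ _ _ h => ?_
    cases d₄ with | var _ _ _ h' => ?_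
    obtain ⟨hA, ⟨D⟩, E⟩ := ihM _ _ hf _ _ rfl d₁
    obtain ⟨hA', ⟨D'⟩, E'⟩ := ihN (A :: Γ) _ (fun n σ h => hf n σ h) _ _ rfl d₂
    simp only [VType.comp.injEq, CType.bang.injEq] at hA hA'
    subst hA hA'
    simp only [Nat.zero_add, List.getElem?_cons_zero, List.getElem?_cons_succ,
      Option.some.injEq] at h h'
    subst h h'
    simp only [cps, cbvcps, Tm.rename, cbvT, cpsV, cpsC, cbvcpsT_eq, Tm.liftN, Tm.rename_shift]
    have K : Deriv (cpsV R (cbvT τ) :: cpsV R (cbvT σ) :: cpsCtx R Γ)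
        (some (.carr (.prod (cpsV R (cbvT σ)) (cpsV R (cbvT τ))) R))
        (.capp .svar (.vpair (.var 1) (.var 0))) (.comp R) :=
      .capp _ _ _ _ _ _ (.svar _ _) (.vpair _ _ _ _ _ (.var _ _ _ rfl) (.var _ _ _ rfl))
    have K' := Deriv.lapp _ _ _ _ _ _ D'
      (.clam _ _ _ _ _ (.lapp _ _ _ _ _ _ (.llam _ _ _ _ K) (.svar _ _)))
    exact ⟨trivial,
      ⟨.llam _ _ _ _ (.lapp _ _ _ _ _ _ D
        (.clam _ _ _ _ _ (.lapp _ _ _ _ _ _ (.llam _ _ _ _ K') (.svar _ _))))⟩,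
      .llam_cong (.lapp_cong E (.clam_cong (.lapp_llam_svar
        (.lapp_cong E' (.clam_cong (.lapp_llam_svar (.refl K) K))) K')))⟩
  | app Θ M N σ τ dM dN ihM ihN =>
    intro Γ f hf t T ht d'
    simp only [cbvTm, Tm.rename, Tm.liftN, Tm.rename_shift] at ht
    subst ht
    cases d' with | banglet _ _ _ _ A B d₁ d₂ => ?_
    cases d₂ with | banglet _ _ _ _ A' _ d₂ d₃ => ?_
    cases d₃ with | vapp _ _ _ B' _ d₃ d₄ => ?_
    cases d₃ with | var _ _ _ h => ?_
    cases d₄ with | var _ _ _ h' => ?_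
    obtain ⟨hA, ⟨D⟩, E⟩ := ihM _ _ hf _ _ rfl d₁
    obtain ⟨hA', ⟨D'⟩, E'⟩ := ihN (A :: Γ) _ (fun n σ h => hf n σ h) _ _ rfl d₂
    simp only [VType.comp.injEq, CType.bang.injEq] at hA hA'
    subst hA hA'
    simp only [Nat.zero_add, List.getElem?_cons_zero, List.getElem?_cons_succ, cbvT,
      Option.some.injEq, VType.arr.injEq, VType.comp.injEq] at h h'
    obtain ⟨rfl, rfl⟩ := h
    simp only [cbvT, cpsV, cpsC] at D E
    simp only [cps, cbvcps, Tm.rename, cbvT, cpsV, cpsC, cbvcpsT_eq, Tm.liftN, Tm.rename_shift]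
    have K : Deriv (cpsV R (cbvT σ) ::
          .arr (cpsV R (cbvT σ)) (.lin (.carr (cpsV R (cbvT τ)) R) R) :: cpsCtx R Γ)
        (some (.carr (cpsV R (cbvT τ)) R)) (.lapp (.vapp (.var 1) (.var 0)) .svar) (.comp R) :=
      .lapp _ _ _ _ _ _
        (.vapp _ _ _ _ _ (.var _ _ _ rfl) (.var _ _ _ rfl)) (.svar _ _)
    have K' := Deriv.lapp _ _ _ _ _ _ D' (.clam _ _ _ _ _ K)
    exact ⟨trivial,
      ⟨.llam _ _ _ _ (.lapp _ _ _ _ _ _ D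
        (.clam _ _ _ _ _ (.lapp _ _ _ _ _ _ (.llam _ _ _ _ K') (.svar _ _))))⟩,
      .llam_cong (.lapp_cong E (.clam_cong (.lapp_llam_svar
        (.lapp_cong E' (.clam_cong (.refl K))) K')))⟩

/-- **Recovering the call-by-value linear-use CPS translation**
(Theorem 6.1): for every simple type `σ`, `σᵛᶜ = (σᵛ)ᶜ`; and for every
simply-typed term `Θ ⊢ M : σ`,
`Θᵛᶜ ⊢ Mᵛᶜ = (Mᵛ)ᶜ : (σᵛᶜ ⇒ R̲) ⊸ R̲` in the equational theory of EEC.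
That is, the cbv linear-use CPS translation is the composite of the standard
cbv translation into EEC with the generic linear-use CPS self-translation. -/
theorem recover_cbvcps (R : CType) :
    (∀ σ : STy, cbvcpsT R σ = cpsV R (cbvT σ)) ∧
    (∀ (Θ : List STy) (M : LTm) (σ : STy) (d : LDeriv Θ M σ)
        (d' : Deriv (cbvCtx Θ) none (cbvTm M) (.comp (.bang (cbvT σ)))),
      EEq (cbvcpsCtx R Θ) none (cbvcps R d) (cps R d')
        (.lin (.carr (cbvcpsT R σ) R) R)) := by
  refine ⟨cbvcpsT_eq R, fun Θ M σ d d' => ?_⟩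
  have h := (cbvcps_eq_cps R d (cbvCtx Θ) id (fun n σ h => by simp [cbvCtx, h]) _ _
    (Tm.rename_id _).symm d').2.2
  rwa [Tm.rename_id, cpsCtx_cbvCtx, ← cbvcpsT_eq] at h

end EEC
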